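/- (Strongly adaptive regret of CBCE with black-box B) Assume each loss function f_t : 𝒟 → [0,1] is convex, let 𝒲 ⊆ 𝒟 be the comparator set, let α ∈ (0,1) and c > 0, and assume that the black-box runs satisfy the anytime regret bound ∑_{t∈J} ( f_t(x_t^{B_J}) − f_t(w) ) ≤ c·|J|^α for every J ∈ 𝒥 and every w ∈ 𝒲. Then for every interval I = [I₁..I₂] with I₂ ≤ T and every w ∈ 𝒲, the CBCE algorithm satisfies ∑_{t∈I} ( f_t(x_t) − f_t(w) ) ≤ (4/(2^α − 1))·c·|I|^α + 8·sqrt( |I|·(7·ln(I₂) + 5) ). -/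

import Mathlib

open scoped Classical

/-- `isGC A B` means the interval `[A..B]` belongs to the geometric covering
collection `𝒥 = ⋃_k {[i·2^k .. (i+1)·2^k − 1] : i ≥ 1}`. -/
def isGC (A B : ℕ) : Prop := ∃ k i : ℕ, 1 ≤ i ∧ A = i * 2 ^ k ∧ B = (i + 1) * 2 ^ k - 1

/-- The (finite) collection of geometric covering intervals containing time `t`. -/
noncomputable def Active (t : ℕ) : Finset (ℕ × ℕ) :=
  (Finset.Icc 1 t ×ˢ Finset.Icc t (2 * t)).filter fun q => isGC q.1 q.2 ∧ q.1 ≤ t ∧ t ≤ q.2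


/-- `n` times the relative entropy of the coin with bias `z / n` with respect to a fair coin. -/
noncomputable def coinEntropy (n z : ℝ) : ℝ :=
  ((n + z) * Real.log (n + z) + (n - z) * Real.log (n - z)) / 2 - n * Real.log n

/-- A lower bound on the wealth of the Krichevsky–Trofimov bettor after `n` rounds
whose outcomes sum to `z`. -/
noncomputable def ktPotential (n z : ℝ) : ℝ :=
  Real.exp (coinEntropy n z - Real.log (4 * n + 1) / 2)

lemma coinEntropy_neg (n z : ℝ) : coinEntropy n (-z) = coinEntropy n z := by
  unfold coinEntropy; ring_nf

lemma ktPotential_neg (n z : ℝ) : ktPotential n (-z) = ktPotential n z := by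
  unfold ktPotential; rw [coinEntropy_neg]

lemma ktPotential_zero : ktPotential 0 0 = 1 := by
  simp [ktPotential, coinEntropy]

lemma mul_log_ge_legendre {y : ℝ} (hy : 0 ≤ y) (s : ℝ) :
    y * (s + 1) - Real.exp s ≤ y * Real.log y := by
  rcases hy.eq_or_lt with rfl | hy
  · simp [Real.exp_nonneg]
  · have h := Real.log_le_sub_one_of_pos (div_pos (Real.exp_pos s) hy)
    rw [Real.log_div (Real.exp_pos s).ne' hy.ne', Real.log_exp] at h
    have h2 := mul_le_mul_of_nonneg_left h hy.le
    have h3 : y * (Real.exp s / y - 1) = Real.exp s - y := by field_simp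
    nlinarith

lemma sq_div_le_coinEntropy {n z : ℝ} (hn : 0 < n) (hz : |z| ≤ n) :
    z ^ 2 / (2 * n) ≤ coinEntropy n z := by
  obtain ⟨h1, h2⟩ := abs_le.mp hz
  set x := z / n with hx
  have hzx : z = n * x := by rw [hx]; field_simp
  have hp := mul_log_ge_legendre (by linarith : 0 ≤ n + z) (x - x ^ 2 / 2 + Real.log n)
  have hm := mul_log_ge_legendre (by linarith : 0 ≤ n - z) (-x - x ^ 2 / 2 + Real.log n)
  rw [Real.exp_add, Real.exp_log hn, sub_eq_add_neg x, Real.exp_add] at hp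
  rw [Real.exp_add, Real.exp_log hn, sub_eq_add_neg (-x), Real.exp_add] at hm
  have hc := Real.cosh_le_exp_half_sq x
  rw [Real.cosh_eq] at hc
  have he : Real.exp (x ^ 2 / 2) * Real.exp (-(x ^ 2 / 2)) = 1 := by
    rw [← Real.exp_add]; simp
  have hq : (Real.exp x + Real.exp (-x)) * Real.exp (-(x ^ 2 / 2)) ≤ 2 := by
    have := mul_le_mul_of_nonneg_right hc (Real.exp_pos (-(x ^ 2 / 2))).le
    linarith
  have hq' := mul_le_mul_of_nonneg_right hq hn.le
  have hl : z ^ 2 / (2 * n) = n * x ^ 2 / 2 := by rw [hzx]; field_simp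
  rw [hl]
  unfold coinEntropy
  rw [hzx] at hp hm ⊢
  nlinarith

lemma antitoneOn_kt_increment :
    AntitoneOn (fun u : ℝ => Real.log (u + 1) + u * Real.log u / 2
      - (u + 2) * Real.log (u + 2) / 2) (Set.Ici 0) := by
  have hd : ∀ u : ℝ, 0 < u → HasDerivAt (fun u : ℝ => Real.log (u + 1) + u * Real.log u / 2
      - (u + 2) * Real.log (u + 2) / 2)
      (1 / (u + 1) + (Real.log u + 1) / 2 - (Real.log (u + 2) + 1) / 2) u := by
    intro u hu
    have e1 : HasDerivAt (fun u : ℝ => Real.log (u + 1)) (1 / (u + 1)) u :=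
      ((hasDerivAt_id u).add_const 1).log (by simp; positivity)
    have e2 := Real.hasDerivAt_mul_log hu.ne'
    have e3 : HasDerivAt (fun u : ℝ => (u + 2) * Real.log (u + 2)) (Real.log (u + 2) + 1) u :=
      (Real.hasDerivAt_mul_log (by positivity : u + 2 ≠ 0)).comp_add_const u 2
    exact (e1.add (e2.div_const 2)).sub (e3.div_const 2)
  refine antitoneOn_of_deriv_nonpos (convex_Ici 0) ?_ ?_ ?_
  · have h1 : ContinuousOn (fun u : ℝ => Real.log (u + 1)) (Set.Ici 0) :=
      ContinuousOn.log (by fun_prop) (fun u hu => by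
        have : (0 : ℝ) ≤ u := hu
        positivity)
    have h2 : Continuous fun u : ℝ => u * Real.log u := Real.continuous_mul_log
    have h3 : Continuous fun u : ℝ => (u + 2) * Real.log (u + 2) :=
      Real.continuous_mul_log.comp (continuous_id.add continuous_const)
    exact (h1.add (h2.div_const 2).continuousOn).sub (h3.div_const 2).continuousOn
  · intro u hu
    rw [interior_Ici] at hu
    exact (hd u hu).differentiableAt.differentiableWithinAt
  · intro u hu
    rw [interior_Ici] at hu
    have hu : 0 < u := hu
    rw [(hd u hu).deriv]
    have h := Real.le_log_one_add_of_nonneg (by positivity : 0 ≤ 2 / u)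
    have h1 : 2 * (2 / u) / (2 / u + 2) = 2 / (u + 1) := by field_simp; ring
    have h2 : 1 + 2 / u = (u + 2) / u := by field_simp
    rw [h1, h2, Real.log_div (by positivity) hu.ne'] at h
    have h3 : 2 / (u + 1) = 2 * (1 / (u + 1)) := by ring
    linarith

lemma ktPotential_step_one {n z : ℝ} (hn : 0 ≤ n) (hz : |z| ≤ n) :
    ktPotential (n + 1) (z + 1) ≤ (1 + z / (n + 1)) * ktPotential n z := by
  obtain ⟨h1, h2⟩ := abs_le.mp hz
  have hpos : 0 < n + z + 1 := by linarith
  have hn1 : 0 < n + 1 := by linarith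
  have hr : 1 + z / (n + 1) = Real.exp (Real.log (n + z + 1) - Real.log (n + 1)) := by
    rw [Real.exp_sub, Real.exp_log hpos, Real.exp_log hn1]; field_simp; ring
  unfold ktPotential
  rw [hr, ← Real.exp_add]
  apply Real.exp_le_exp.mpr
  have hanti := antitoneOn_kt_increment (a := n + z) (b := 2 * n)
    (by simp; linarith) (by simp; linarith) (by linarith)
  simp only at hanti
  have e1 : n * Real.log (2 * n) = n * Real.log n + n * Real.log 2 := by
    rcases hn.eq_or_lt with h | h
    · simp [← h]
    · rw [Real.log_mul (by norm_num) h.ne']; ring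
  have e2 : Real.log (2 * n + 2) = Real.log 2 + Real.log (n + 1) := by
    rw [← Real.log_mul (by norm_num) hn1.ne']; ring_nf
  rw [e2] at hanti
  have e3 : 2 * Real.log (2 * (n + 1)) + Real.log (4 * n + 1)
      ≤ 2 * Real.log (2 * n + 1) + Real.log (4 * (n + 1) + 1) := by
    have k1 : 2 * Real.log (2 * (n + 1)) = Real.log ((2 * (n + 1)) ^ 2) := by
      rw [Real.log_pow]; norm_num
    have k2 : 2 * Real.log (2 * n + 1) = Real.log ((2 * n + 1) ^ 2) := by
      rw [Real.log_pow]; norm_num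
    rw [k1, k2, ← Real.log_mul (by positivity) (by positivity),
      ← Real.log_mul (by positivity) (by positivity)]
    apply Real.log_le_log (by positivity)
    nlinarith
  rw [Real.log_mul (by norm_num) hn1.ne'] at e3
  unfold coinEntropy
  have a1 : n + 1 + (z + 1) = n + z + 2 := by ring
  have a2 : n + 1 - (z + 1) = n - z := by ring
  rw [a1, a2]
  nlinarith

lemma convexOn_ktPotential (n : ℝ) :
    ConvexOn ℝ (Set.Icc (-n) n) (ktPotential n) := by
  refine ⟨convex_Icc _ _, ?_⟩
  intro x hx y hy a b ha hb hab
  have hp := Real.convexOn_mul_log.2 (x := n + x) (y := n + y)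
    (by simp; linarith [hx.1]) (by simp; linarith [hy.1]) ha hb hab
  have hm := Real.convexOn_mul_log.2 (x := n - x) (y := n - y)
    (by simp; linarith [hx.2]) (by simp; linarith [hy.2]) ha hb hab
  have hE := convexOn_exp.2 (x := coinEntropy n x - Real.log (4 * n + 1) / 2)
    (y := coinEntropy n y - Real.log (4 * n + 1) / 2) trivial trivial ha hb hab
  simp only [smul_eq_mul] at *
  refine le_trans (Real.exp_le_exp.mpr ?_) hE
  have e1 : a * (n + x) + b * (n + y) = n + (a * x + b * y) := by
    linear_combination n * hab
  have e2 : a * (n - x) + b * (n - y) = n - (a * x + b * y) := by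
    linear_combination n * hab
  rw [e1] at hp
  rw [e2] at hm
  unfold coinEntropy
  have hb' : b = 1 - a := by linarith
  subst hb'
  nlinarith

lemma ktPotential_step {n z g : ℝ} (hn : 0 ≤ n) (hz : |z| ≤ n) (hg : |g| ≤ 1) :
    ktPotential (n + 1) (z + g) ≤ (1 + g * (z / (n + 1))) * ktPotential n z := by
  obtain ⟨h1, h2⟩ := abs_le.mp hz
  obtain ⟨g1, g2⟩ := abs_le.mp hg
  have hc := (convexOn_ktPotential (n + 1)).2 (x := z + 1) (y := z - 1)
    ⟨by linarith, by linarith⟩ ⟨by linarith, by linarith⟩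
    (by linarith : 0 ≤ (1 + g) / 2) (by linarith : 0 ≤ (1 - g) / 2) (by ring)
  simp only [smul_eq_mul] at hc
  have e : (1 + g) / 2 * (z + 1) + (1 - g) / 2 * (z - 1) = z + g := by ring
  rw [e] at hc
  have hp := ktPotential_step_one hn hz
  have hm := ktPotential_step_one hn (by rwa [abs_neg] : |-z| ≤ n)
  have e2 : -z + 1 = -(z - 1) := by ring
  rw [e2, ktPotential_neg, ktPotential_neg, neg_div] at hm
  have hp' := mul_le_mul_of_nonneg_left hp (by linarith : 0 ≤ (1 + g) / 2)
  have hm' := mul_le_mul_of_nonneg_left hm (by linarith : 0 ≤ (1 - g) / 2)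
  nlinarith

lemma isGC.one_le {A B : ℕ} (h : isGC A B) : 1 ≤ A := by
  obtain ⟨k, i, hi, rfl, -⟩ := h
  exact Nat.mul_pos hi (by positivity)

lemma isGC.exists_length {A B : ℕ} (h : isGC A B) :
    ∃ k, k ≤ Nat.log 2 A ∧ 2 ^ k ≤ A ∧ B + 1 = A + 2 ^ k := by
  obtain ⟨k, i, hi, rfl, rfl⟩ := h
  have h2 : 0 < 2 ^ k := by positivity
  have h3 : 2 ^ k ≤ i * 2 ^ k := Nat.le_mul_of_pos_left _ hi
  refine ⟨k, Nat.le_log_of_pow_le (by norm_num) h3, h3, ?_⟩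
  rw [add_mul, one_mul]
  omega

lemma mem_Active {t : ℕ} {q : ℕ × ℕ} :
    q ∈ Active t ↔ isGC q.1 q.2 ∧ q.1 ≤ t ∧ t ≤ q.2 := by
  unfold Active
  simp only [Finset.mem_filter, Finset.mem_product, Finset.mem_Icc]
  refine ⟨fun h => h.2, fun h => ⟨?_, h⟩⟩
  obtain ⟨k, -, h2, h3⟩ := h.1.exists_length
  have := h.1.one_le
  omega

lemma Active_nonempty {t : ℕ} (ht : 1 ≤ t) : (Active t).Nonempty :=
  ⟨(t, t), mem_Active.mpr ⟨⟨0, t, ht, by simp, by simp⟩, le_rfl, le_rfl⟩⟩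

/-- The unnormalized prior weight of an interval starting at `A`. -/
noncomputable def priorWeight (A : ℕ) : ℝ := 1 / ((A : ℝ) ^ 2 * (1 + (Nat.log 2 A : ℝ)))

lemma priorWeight_nonneg (A : ℕ) : 0 ≤ priorWeight A := by
  unfold priorWeight; positivity

lemma priorWeight_pos {A : ℕ} (hA : 1 ≤ A) : 0 < priorWeight A := by
  unfold priorWeight
  have : (0 : ℝ) < A := by exact_mod_cast hA
  positivity

lemma sum_inv_sq_le_two (M : ℕ) : ∑ A ∈ Finset.range (M + 1), 1 / (A : ℝ) ^ 2 ≤ 2 := by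
  have h : ∀ M : ℕ, ∑ A ∈ Finset.range (M + 2), 1 / (A : ℝ) ^ 2 ≤ 2 - 1 / ((M : ℝ) + 1) := by
    intro M
    induction M with
    | zero => simp [Finset.sum_range_succ]; norm_num
    | succ M ih =>
      rw [Finset.sum_range_succ]
      have h0 : (0 : ℝ) < (M : ℝ) + 1 := by positivity
      have h1 : 1 / ((M + 1 + 1 : ℕ) : ℝ) ^ 2 ≤ 1 / ((M : ℝ) + 1) - 1 / ((M : ℝ) + 1 + 1) := by
        push_cast
        rw [div_sub_div _ _ (by positivity) (by positivity),
          div_le_div_iff₀ (by positivity) (by positivity)]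
        nlinarith
      push_cast at h1 ih ⊢
      rw [add_assoc (M : ℝ) 1 1, one_add_one_eq_two] at h1 ⊢
      linarith
  calc ∑ A ∈ Finset.range (M + 1), 1 / (A : ℝ) ^ 2
      ≤ ∑ A ∈ Finset.range (M + 2), 1 / (A : ℝ) ^ 2 :=
        Finset.sum_le_sum_of_subset_of_nonneg (Finset.range_mono (by omega))
          (fun _ _ _ => by positivity)
    _ ≤ 2 - 1 / ((M : ℝ) + 1) := h M
    _ ≤ 2 := by
        have : (0 : ℝ) ≤ 1 / ((M : ℝ) + 1) := by positivity
        linarith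

lemma sum_priorWeight_le_two (Q : Finset (ℕ × ℕ)) (hQ : ∀ q ∈ Q, isGC q.1 q.2) :
    ∑ q ∈ Q, priorWeight q.1 ≤ 2 := by
  set M := Q.sup Prod.fst with hM
  have hmaps : ∀ q ∈ Q, q.1 ∈ Finset.range (M + 1) := fun q hq => by
    have : q.1 ≤ M := Finset.le_sup (f := Prod.fst) hq
    simp; omega
  rw [← Finset.sum_fiberwise_of_maps_to hmaps]
  refine le_trans (Finset.sum_le_sum fun A _ => ?_) (sum_inv_sq_le_two M)
  have hcard : (Q.filter fun q => q.1 = A).card ≤ Nat.log 2 A + 1 := by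
    have hsub : (Q.filter fun q => q.1 = A) ⊆
        (Finset.range (Nat.log 2 A + 1)).image fun k => (A, A + 2 ^ k - 1) := by
      rintro ⟨a, b⟩ hq
      rw [Finset.mem_filter] at hq
      obtain ⟨hq, rfl⟩ := hq
      obtain ⟨k, hk, -, hb⟩ := (hQ _ hq).exists_length
      simp only at hk hb ⊢
      refine Finset.mem_image.mpr ⟨k, by simp; omega, ?_⟩
      ext
      · rfl
      · simp only; omega
    exact (Finset.card_le_card hsub).trans (Finset.card_image_le.trans (by simp))
  have hsum : ∑ q ∈ Q with q.1 = A, priorWeight q.1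
      = (Q.filter fun q => q.1 = A).card * priorWeight A := by
    rw [Finset.sum_congr rfl (g := fun _ => priorWeight A), Finset.sum_const, nsmul_eq_mul]
    intro q hq
    rw [(Finset.mem_filter.mp hq).2]
  rw [hsum]
  have hcard' : ((Q.filter fun q => q.1 = A).card : ℝ) ≤ 1 + (Nat.log 2 A : ℝ) := by
    rw [add_comm]; exact_mod_cast hcard
  refine (mul_le_mul_of_nonneg_right hcard' (priorWeight_nonneg A)).trans (le_of_eq ?_)
  unfold priorWeight
  have : (1 + (Nat.log 2 A : ℝ)) ≠ 0 := by positivity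
  rw [one_div, mul_inv, one_div, mul_comm, mul_assoc, inv_mul_cancel₀ this, mul_one]

lemma sum_subtype_priorWeight_le_two (Q : Finset {q : ℕ × ℕ // isGC q.1 q.2}) :
    ∑ J ∈ Q, priorWeight J.1.1 ≤ 2 := by
  have h := sum_priorWeight_le_two (Q.map (Function.Embedding.subtype _)) (by
    intro q hq
    obtain ⟨J, -, rfl⟩ := Finset.mem_map.mp hq
    exact J.2)
  rwa [Finset.sum_map] at h

lemma summable_priorWeight :
    Summable fun J : {q : ℕ × ℕ // isGC q.1 q.2} => priorWeight J.1.1 :=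
  summable_of_sum_le (fun _ => priorWeight_nonneg _) sum_subtype_priorWeight_le_two

lemma tsum_priorWeight_le_two :
    ∑' J : {q : ℕ × ℕ // isGC q.1 q.2}, priorWeight J.1.1 ≤ 2 :=
  summable_priorWeight.tsum_le_of_sum_le sum_subtype_priorWeight_le_two

lemma sum_priorWeight_le_tsum (Q : Finset (ℕ × ℕ)) (hQ : ∀ q ∈ Q, isGC q.1 q.2) :
    ∑ q ∈ Q, priorWeight q.1 ≤ ∑' J : {q : ℕ × ℕ // isGC q.1 q.2}, priorWeight J.1.1 := by
  rw [← Finset.sum_subtype_of_mem (fun q : ℕ × ℕ => priorWeight q.1) hQ]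
  exact summable_priorWeight.sum_le_tsum _ (fun _ _ => priorWeight_nonneg _)

lemma tsum_priorWeight_pos :
    0 < ∑' J : {q : ℕ × ℕ // isGC q.1 q.2}, priorWeight J.1.1 := by
  have h := sum_priorWeight_le_tsum {(1, 1)}
    (by simp only [Finset.mem_singleton, forall_eq]; exact ⟨0, 1, le_rfl, by simp, by simp⟩)
  rw [Finset.sum_singleton] at h
  exact (priorWeight_pos le_rfl).trans_le h

section Decomposition

variable {N : ℕ} {r F : ℕ → ℝ}

lemma sum_suffix_le (hF : ∀ k, 0 ≤ F k)
    (hr : ∀ k i : ℕ, 1 ≤ i → (i + 1) * 2 ^ k ≤ N →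
      ∑ t ∈ Finset.Ico (i * 2 ^ k) ((i + 1) * 2 ^ k), r t ≤ F k)
    (k : ℕ) : ∀ i A : ℕ, 1 ≤ A → A ≤ i * 2 ^ k → i * 2 ^ k ≤ N → i * 2 ^ k < A + 2 ^ k →
      ∑ t ∈ Finset.Ico A (i * 2 ^ k), r t ≤ ∑ j ∈ Finset.range k, F j := by
  induction k with
  | zero =>
    intro i A _ h1 _ h2
    rw [Finset.Ico_eq_empty (by simp at *; omega)]; simp
  | succ k ih =>
    intro i A hA h1 hN h2
    have e : i * 2 ^ (k + 1) = (2 * i) * 2 ^ k := by ring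
    rw [e] at h1 h2 hN ⊢
    rw [Finset.sum_range_succ]
    by_cases h : 2 * i * 2 ^ k < A + 2 ^ k
    · linarith [ih (2 * i) A hA h1 hN h, hF k]
    · obtain ⟨m, hm⟩ : ∃ m, 2 * i = m + 1 := by
        rcases Nat.eq_zero_or_pos i with rfl | hi
        · simp at h1; omega
        · exact ⟨2 * i - 1, by omega⟩
      rw [hm] at h1 h2 hN h ⊢
      have e2 : (m + 1) * 2 ^ k = m * 2 ^ k + 2 ^ k := by ring
      have e3 : 2 ^ (k + 1) = 2 ^ k + 2 ^ k := by ring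
      have hAm : A ≤ m * 2 ^ k := by omega
      have hm1 : 1 ≤ m := by
        rcases Nat.eq_zero_or_pos m with rfl | hm
        · simp at hAm; omega
        · exact hm
      rw [← Finset.sum_Ico_consecutive r hAm (by omega)]
      linarith [ih m A hA hAm (by omega) (by omega), hr k m hm1 hN]

lemma sum_prefix_le (hF : ∀ k, 0 ≤ F k)
    (hr : ∀ k i : ℕ, 1 ≤ i → (i + 1) * 2 ^ k ≤ N →
      ∑ t ∈ Finset.Ico (i * 2 ^ k) ((i + 1) * 2 ^ k), r t ≤ F k)
    (k : ℕ) : ∀ i M : ℕ, 1 ≤ i → i * 2 ^ k ≤ M → M ≤ N → M < i * 2 ^ k + 2 ^ k →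
      ∑ t ∈ Finset.Ico (i * 2 ^ k) M, r t ≤ ∑ j ∈ Finset.range k, F j := by
  induction k with
  | zero =>
    intro i M _ h1 _ h2
    rw [Finset.Ico_eq_empty (by simp at *; omega)]; simp
  | succ k ih =>
    intro i M hi h1 hN h2
    have e : i * 2 ^ (k + 1) = (2 * i) * 2 ^ k := by ring
    rw [e] at h1 h2 ⊢
    rw [Finset.sum_range_succ]
    by_cases h : M < 2 * i * 2 ^ k + 2 ^ k
    · linarith [ih (2 * i) M (by omega) h1 hN h, hF k]
    · have e2 : (2 * i + 1) * 2 ^ k = 2 * i * 2 ^ k + 2 ^ k := by ring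
      have e3 : 2 ^ (k + 1) = 2 ^ k + 2 ^ k := by ring
      rw [← Finset.sum_Ico_consecutive r (n := (2 * i + 1) * 2 ^ k) (by omega) (by omega)]
      linarith [ih (2 * i + 1) M (by omega) (by omega) hN (by omega),
        hr k (2 * i) (by omega) (by omega)]

lemma sum_Ico_le_two_mul_sum_scales (hF : ∀ k, 0 ≤ F k)
    (hr : ∀ k i : ℕ, 1 ≤ i → (i + 1) * 2 ^ k ≤ N →
      ∑ t ∈ Finset.Ico (i * 2 ^ k) ((i + 1) * 2 ^ k), r t ≤ F k)
    {A K : ℕ} (hA : 1 ≤ A) (hAN : A + 2 ^ K ≤ N) (hNA : N < A + 2 ^ (K + 1)) :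
    ∑ t ∈ Finset.Ico A N, r t ≤ 2 * ∑ j ∈ Finset.range (K + 1), F j := by
  have hpos : 0 < 2 ^ K := by positivity
  obtain ⟨i, hi1, hi2⟩ : ∃ i, A ≤ i * 2 ^ K ∧ i * 2 ^ K < A + 2 ^ K := by
    refine ⟨(A + 2 ^ K - 1) / 2 ^ K, ?_, ?_⟩
    · have := Nat.lt_div_mul_add (a := A + 2 ^ K - 1) hpos
      omega
    · have := Nat.div_mul_le_self (A + 2 ^ K - 1) (2 ^ K)
      omega
  have hi : 1 ≤ i := by
    rcases Nat.eq_zero_or_pos i with rfl | h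
    · simp at hi1; omega
    · exact h
  have e2 : (i + 1) * 2 ^ K = i * 2 ^ K + 2 ^ K := by ring
  have e3 : 2 ^ (K + 1) = 2 ^ K + 2 ^ K := by ring
  rw [← Finset.sum_Ico_consecutive r hi1 (by omega : i * 2 ^ K ≤ N), Finset.sum_range_succ]
  have hs := sum_suffix_le hF hr K i A hA hi1 (by omega) hi2
  by_cases h : N < i * 2 ^ K + 2 ^ K
  · linarith [sum_prefix_le hF hr K i N hi (by omega) le_rfl h, hF K]
  · rw [← Finset.sum_Ico_consecutive r (m := i * 2 ^ K) (n := (i + 1) * 2 ^ K)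
      (by omega) (by omega)]
    linarith [sum_prefix_le hF hr K (i + 1) N (by omega) (by omega) le_rfl (by omega),
      hr K i hi (by omega), hF K]

end Decomposition

lemma sum_geometric_le {b y : ℝ} (hb : 1 < b) {K : ℕ} (hy : b ^ K ≤ y) :
    ∑ j ∈ Finset.range (K + 1), b ^ j ≤ b * y / (b - 1) := by
  rw [geom_sum_eq hb.ne']
  have : 0 < b - 1 := by linarith
  apply div_le_div_of_nonneg_right _ this.le
  rw [pow_succ]
  nlinarith

lemma two_mul_sum_scales_le {α c L y : ℝ} (hα : α ∈ Set.Ioo (0 : ℝ) 1) (hc : 0 < c)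
    {K : ℕ} (hy : (2 : ℝ) ^ K ≤ y) :
    2 * ∑ j ∈ Finset.range (K + 1), (c * ((2 : ℝ) ^ j) ^ α + Real.sqrt (2 ^ j * L)) ≤
      4 / (2 ^ α - 1) * c * y ^ α + 8 * Real.sqrt (y * L) := by
  obtain ⟨hα0, hα1⟩ := hα
  have hy0 : 0 ≤ y := le_trans (by positivity) hy
  have hpow : ∀ j : ℕ, ((2 : ℝ) ^ j) ^ α = (2 ^ α) ^ j := fun j => by
    rw [← Real.rpow_natCast, ← Real.rpow_natCast, ← Real.rpow_mul (by norm_num),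
      ← Real.rpow_mul (by norm_num), mul_comm]
  have hsqrt : ∀ j : ℕ, Real.sqrt (2 ^ j * L) = Real.sqrt 2 ^ j * Real.sqrt L := fun j => by
    rw [Real.sqrt_mul (by positivity), Real.sqrt_eq_iff_mul_self_eq (y := Real.sqrt 2 ^ j)
      (by positivity) (by positivity) |>.mpr]
    rw [← mul_pow, Real.mul_self_sqrt (by norm_num)]
  simp only [hpow, hsqrt, Finset.sum_add_distrib, ← Finset.mul_sum, ← Finset.sum_mul]
  have hb1 : (1 : ℝ) < 2 ^ α := Real.one_lt_rpow (by norm_num) hα0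
  have hb2 : (2 : ℝ) ^ α ≤ 2 := by
    simpa using Real.rpow_le_rpow_of_exponent_le (by norm_num : (1 : ℝ) ≤ 2) hα1.le
  have h1 := sum_geometric_le hb1 (K := K) (y := y ^ α) (by
    rw [← hpow]; exact Real.rpow_le_rpow (by positivity) hy hα0.le)
  have hs : (1.4 : ℝ) < Real.sqrt 2 := Real.lt_sqrt_of_sq_lt (by norm_num)
  have h2 := sum_geometric_le (b := Real.sqrt 2) (by linarith) (K := K) (y := Real.sqrt y) (by
    apply Real.le_sqrt_of_sq_le
    rw [← pow_mul, mul_comm, pow_mul, Real.sq_sqrt (by norm_num)]; exact hy)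
  have h3 : Real.sqrt 2 * Real.sqrt y / (Real.sqrt 2 - 1) ≤ 4 * Real.sqrt y := by
    rw [div_le_iff₀ (by linarith)]
    nlinarith [Real.sqrt_nonneg y]
  have h4 : 2 ^ α * y ^ α / (2 ^ α - 1) ≤ 2 / (2 ^ α - 1) * y ^ α := by
    rw [div_mul_eq_mul_div]
    apply div_le_div_of_nonneg_right _ (by linarith)
    exact mul_le_mul_of_nonneg_right hb2 (Real.rpow_nonneg hy0 α)
  have h5 := mul_le_mul_of_nonneg_left (h1.trans h4) hc.le
  have h6 := mul_le_mul_of_nonneg_right (h2.trans h3) (Real.sqrt_nonneg L)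
  rw [Real.sqrt_mul hy0]
  have h7 : 4 / (2 ^ α - 1) * c * y ^ α = 2 * (c * (2 / (2 ^ α - 1) * y ^ α)) := by ring
  rw [h7]
  linarith

lemma abs_le_and_ktPotential_le_wealth (P : ℕ → Prop) [DecidablePred P]
    (T : ℕ) (g w : ℕ → ℝ)
    (hg : ∀ t ∈ Finset.Icc 1 T, P t → |g t| ≤ 1)
    (hw : ∀ t ∈ Finset.Icc 1 T, P t → w t =
      (∑ τ ∈ Finset.Icc 1 (t - 1), if P τ then g τ else 0) /
          ((1 + ∑ τ ∈ Finset.Icc 1 (t - 1), if P τ then 1 else 0 : ℕ) : ℝ) *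
        (1 + ∑ τ ∈ Finset.Icc 1 (t - 1), if P τ then g τ * w τ else 0)) :
    ∀ t ≤ T,
      |∑ τ ∈ Finset.Icc 1 t, if P τ then g τ else 0| ≤
        ((∑ τ ∈ Finset.Icc 1 t, if P τ then 1 else 0 : ℕ) : ℝ) ∧
      ktPotential ((∑ τ ∈ Finset.Icc 1 t, if P τ then 1 else 0 : ℕ) : ℝ)
          (∑ τ ∈ Finset.Icc 1 t, if P τ then g τ else 0) ≤
        1 + ∑ τ ∈ Finset.Icc 1 t, if P τ then g τ * w τ else 0 := by
  intro t
  induction t with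
  | zero => intro _; simp [ktPotential_zero]
  | succ t ih =>
    intro ht
    obtain ⟨ih1, ih2⟩ := ih (by omega)
    have hmem : t + 1 ∈ Finset.Icc 1 T := by simp; omega
    have hg' := hg _ hmem
    have hw' := hw _ hmem
    rw [Nat.add_sub_cancel] at hw'
    simp only [Finset.sum_Icc_succ_top (by omega : 1 ≤ t + 1)]
    set z := ∑ τ ∈ Finset.Icc 1 t, if P τ then g τ else 0
    set n := ∑ τ ∈ Finset.Icc 1 t, if P τ then 1 else 0
    set W := ∑ τ ∈ Finset.Icc 1 t, if P τ then g τ * w τ else 0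
    by_cases hP : P (t + 1)
    · simp only [hP, if_true]
      have hg1 := hg' hP
      have hw1 := hw' hP
      push_cast at hw1 ⊢
      have hn : (0 : ℝ) ≤ n := by positivity
      refine ⟨(abs_add_le _ _).trans (add_le_add ih1 hg1), ?_⟩
      refine (ktPotential_step hn ih1 hg1).trans ?_
      have hfac : 0 ≤ 1 + g (t + 1) * (z / (n + 1)) := by
        have hb : |z / ((n : ℝ) + 1)| ≤ 1 := by
          rw [abs_div, abs_of_pos (by positivity : (0 : ℝ) < n + 1), div_le_one (by positivity)]
          linarith
        have := abs_mul (g (t + 1)) (z / ((n : ℝ) + 1))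
        have h2 := mul_le_mul hg1 hb (abs_nonneg _) zero_le_one
        have h3 := neg_abs_le (g (t + 1) * (z / ((n : ℝ) + 1)))
        linarith
      refine (mul_le_mul_of_nonneg_left ih2 hfac).trans (le_of_eq ?_)
      rw [hw1, add_comm (1 : ℝ) (n : ℝ)]
      ring
    · simp only [hP, if_false, add_zero]
      exact ⟨ih1, ih2⟩

lemma le_sqrt_of_ktPotential_le {n A B : ℕ} {z : ℝ} (hn : 1 ≤ n) (hA : 1 ≤ A) (hAB : A ≤ B)
    (hnB : n ≤ B) (hz : |z| ≤ n) (h : ktPotential n z * priorWeight A ≤ 2) :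
    z ≤ Real.sqrt (n * (7 * Real.log B + 5)) := by
  apply Real.le_sqrt_of_sq_le
  have hn' : (1 : ℝ) ≤ n := by exact_mod_cast hn
  have hA' : (1 : ℝ) ≤ A := by exact_mod_cast hA
  have hw : 1 / (A : ℝ) ^ 3 ≤ priorWeight A := by
    unfold priorWeight
    have h1 : (1 + (Nat.log 2 A : ℝ)) ≤ A := by
      have := Nat.log_lt_self 2 (by omega : A ≠ 0)
      have : 1 + Nat.log 2 A ≤ A := by omega
      exact_mod_cast this
    apply one_div_le_one_div_of_le (by positivity)
    nlinarith [mul_le_mul_of_nonneg_left h1 (sq_nonneg (A : ℝ))]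
  have h2 : ktPotential n z ≤ 2 * (A : ℝ) ^ 3 := by
    have h3 : 0 < ktPotential n z := Real.exp_pos _
    have h4 := (mul_le_mul_of_nonneg_left hw h3.le).trans h
    rwa [mul_one_div, div_le_iff₀ (by positivity)] at h4
  have h5 := Real.log_le_log (Real.exp_pos _) h2
  rw [Real.log_exp, Real.log_mul (by norm_num) (by positivity), Real.log_pow] at h5
  have h6 := sq_div_le_coinEntropy (by linarith) hz
  have h7 : Real.log (4 * n + 1) ≤ Real.log 5 + Real.log n := by
    rw [← Real.log_mul (by norm_num) (by positivity)]
    exact Real.log_le_log (by positivity) (by linarith)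
  have h8 : Real.log 5 ≤ 3 * Real.log 2 := by
    have : Real.log ((2 : ℝ) ^ 3) = 3 * Real.log 2 := by rw [Real.log_pow]; norm_num
    rw [← this]
    exact Real.log_le_log (by norm_num) (by norm_num)
  have h9 := Real.log_two_lt_d9
  have h10 : Real.log A ≤ Real.log B := Real.log_le_log (by positivity) (by exact_mod_cast hAB)
  have h11 : Real.log n ≤ Real.log B := Real.log_le_log (by positivity) (by exact_mod_cast hnB)
  rw [div_le_iff₀ (by positivity)] at h6
  have h12 : coinEntropy n z * (2 * n) = n * (2 * coinEntropy n z) := by ring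
  rw [h12] at h6
  refine h6.trans (mul_le_mul_of_nonneg_left ?_ (by positivity))
  push_cast at h5
  linarith

/-- Weights proportional to `a`, with a fallback to `b` when `a` vanishes. -/
lemma sum_normalized_eq_one {ι : Type*} {s : Finset ι} {a b p : ι → ℝ}
    (hb : 0 < ∑ r ∈ s, b r)
    (hp : ∀ q ∈ s, p q =
      if 0 < ∑ r ∈ s, a r then a q / ∑ r ∈ s, a r else b q / ∑ r ∈ s, b r) :
    ∑ q ∈ s, p q = 1 := by
  rw [Finset.sum_congr rfl hp]
  split_ifs with h
  · rw [← Finset.sum_div, div_self h.ne']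
  · rw [← Finset.sum_div, div_self hb.ne']

lemma normalized_nonneg {ι : Type*} {s : Finset ι} {a b p : ι → ℝ}
    (ha : ∀ q ∈ s, 0 ≤ a q) (hb : ∀ q ∈ s, 0 ≤ b q)
    (hp : ∀ q ∈ s, p q =
      if 0 < ∑ r ∈ s, a r then a q / ∑ r ∈ s, a r else b q / ∑ r ∈ s, b r) :
    ∀ q ∈ s, 0 ≤ p q := by
  intro q hq
  rw [hp q hq]
  split_ifs with h
  · exact div_nonneg (ha q hq) h.le
  · exact div_nonneg (hb q hq) (Finset.sum_nonneg hb)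

/-- One round of the sleeping coin-betting reduction does not create prior-weighted wealth. -/
lemma sum_prior_mul_bet_nonpos {ι : Type*} {s : Finset ι} {π w g l p : ι → ℝ} {m : ℝ}
    (hπ : ∀ q ∈ s, 0 ≤ π q)
    (hp : ∀ q ∈ s, p q =
      if 0 < ∑ r ∈ s, π r * max (w r) 0 then π q * max (w q) 0 / ∑ r ∈ s, π r * max (w r) 0
      else π q / ∑ r ∈ s, π r)
    (hg : ∀ q ∈ s, g q = if 0 < w q then m - l q else max (m - l q) 0)
    (hm : m ≤ ∑ q ∈ s, p q * l q) :
    ∑ q ∈ s, π q * (g q * w q) ≤ 0 := by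
  have hle : ∑ q ∈ s, π q * (g q * w q) ≤ ∑ q ∈ s, π q * max (w q) 0 * (m - l q) := by
    refine Finset.sum_le_sum fun q hq => ?_
    rw [hg q hq, mul_assoc]
    refine mul_le_mul_of_nonneg_left ?_ (hπ q hq)
    split_ifs with h
    · rw [max_eq_left h.le, mul_comm]
    · rw [max_eq_right (not_lt.mp h), zero_mul]
      exact mul_nonpos_of_nonneg_of_nonpos (le_max_right _ _) (not_lt.mp h)
  refine hle.trans ?_
  have hnn : ∀ q ∈ s, 0 ≤ π q * max (w q) 0 := fun q hq =>
    mul_nonneg (hπ q hq) (le_max_right _ _)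
  by_cases h : 0 < ∑ r ∈ s, π r * max (w r) 0
  · have e : ∑ q ∈ s, π q * max (w q) 0 * (m - l q)
        = (∑ r ∈ s, π r * max (w r) 0) * (m - ∑ q ∈ s, p q * l q) := by
      rw [mul_sub, Finset.mul_sum, Finset.sum_mul, ← Finset.sum_sub_distrib]
      refine Finset.sum_congr rfl fun q hq => ?_
      rw [hp q hq, if_pos h]
      field_simp
    rw [e]
    exact mul_nonpos_of_nonneg_of_nonpos h.le (by linarith)
  · have h0 := (Finset.sum_eq_zero_iff_of_nonneg hnn).mp
      (le_antisymm (not_lt.mp h) (Finset.sum_nonneg hnn))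
    refine (Finset.sum_eq_zero fun q hq => ?_).le
    rw [h0 q hq, zero_mul]

/-- If no round creates prior-weighted wealth, the wealth on each single interval is controlled by
the total prior mass. -/
lemma priorWeight_mul_wealth_le_tsum (t₀ : ℕ) (b : ℕ → ℕ × ℕ → ℝ)
    (hround : ∀ t ∈ Finset.Icc 1 t₀, ∑ q ∈ Active t, priorWeight q.1 * b t q ≤ 0)
    (hpos : ∀ q : ℕ × ℕ, isGC q.1 q.2 →
      0 ≤ 1 + ∑ τ ∈ Finset.Icc 1 t₀, if q.1 ≤ τ ∧ τ ≤ q.2 then b τ q else 0)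
    {J : ℕ × ℕ} (hJ : isGC J.1 J.2) :
    priorWeight J.1 * (1 + ∑ τ ∈ Finset.Icc 1 t₀, if J.1 ≤ τ ∧ τ ≤ J.2 then b τ J else 0) ≤
      ∑' K : {q : ℕ × ℕ // isGC q.1 q.2}, priorWeight K.1.1 := by
  set Q := insert J ((Finset.Icc 1 t₀).biUnion Active) with hQ
  have hQGC : ∀ q ∈ Q, isGC q.1 q.2 := by
    intro q hq
    rcases Finset.mem_insert.mp hq with rfl | hq
    · exact hJ
    · obtain ⟨t, -, hq⟩ := Finset.mem_biUnion.mp hq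
      exact (mem_Active.mp hq).1
  have hsum : ∑ q ∈ Q, priorWeight q.1 *
      (∑ τ ∈ Finset.Icc 1 t₀, if q.1 ≤ τ ∧ τ ≤ q.2 then b τ q else 0) ≤ 0 := by
    simp only [Finset.mul_sum]
    rw [Finset.sum_comm]
    refine Finset.sum_nonpos fun t ht => ?_
    refine le_trans (le_of_eq ?_) (hround t ht)
    have hsub : Active t ⊆ Q := fun q hq =>
      Finset.mem_insert_of_mem (Finset.mem_biUnion.mpr ⟨t, ht, hq⟩)
    rw [← Finset.sum_subset hsub]
    · refine Finset.sum_congr rfl fun q hq => ?_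
      rw [if_pos (mem_Active.mp hq).2]
    · intro q hq hqA
      rw [if_neg (fun h => hqA (mem_Active.mpr ⟨hQGC q hq, h⟩)), mul_zero]
  refine le_trans ?_ (sum_priorWeight_le_tsum Q hQGC)
  refine le_trans (Finset.single_le_sum (f := fun q : ℕ × ℕ => priorWeight q.1 *
    (1 + ∑ τ ∈ Finset.Icc 1 t₀, if q.1 ≤ τ ∧ τ ≤ q.2 then b τ q else 0))
    (fun q hq => mul_nonneg (priorWeight_nonneg _) (hpos q (hQGC q hq)))
    (Finset.mem_insert_self J _)) ?_
  simp only [mul_add, mul_one, Finset.sum_add_distrib] at hsum ⊢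
  linarith

/-- **Strongly adaptive regret of CBCE with black-box `B`.** Assume each loss
`f_t : 𝒟 → [0,1]` is convex and the black-box runs satisfy the regret bound
`∑_{t∈J} (f_t(x_t^{B_J}) − f_t(w)) ≤ c·|J|^α` on every geometric covering interval `J`
and comparator `w ∈ 𝒲`. Then for every interval `I = [I₁..I₂]` with `I₂ ≤ T` and every
`w ∈ 𝒲`, the CBCE algorithm satisfies
`∑_{t∈I} (f_t(x_t) − f_t(w)) ≤ (4/(2^α−1))·c·|I|^α + 8·√(|I|·(7 ln I₂ + 5))`. -/
theorem cbce_strongly_adaptive_regret {V : Type*} [AddCommGroup V] [Module ℝ V]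
    (D : Set V) (hD : Convex ℝ D) (T : ℕ) (hT : 1 ≤ T)
    (f : ℕ → V → ℝ)
    (hf01 : ∀ t ∈ Finset.Icc 1 T, ∀ y ∈ D, f t y ∈ Set.Icc (0 : ℝ) 1)
    (hfconv : ∀ t ∈ Finset.Icc 1 T, ConvexOn ℝ D (f t))
    -- the black-box decisions
    (xB : ℕ × ℕ → ℕ → V) (hxB : ∀ q : ℕ × ℕ, ∀ t : ℕ, xB q t ∈ D)
    -- the prior over black-box runs
    (Z : ℝ)
    (hZ : Z = ∑' J : {q : ℕ × ℕ // isGC q.1 q.2},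
      1 / ((J.1.1 : ℝ) ^ 2 * (1 + (Nat.log 2 J.1.1 : ℝ))))
    (prior : ℕ × ℕ → ℝ)
    (hprior : ∀ q : ℕ × ℕ,
      prior q = Z⁻¹ * (1 / ((q.1 : ℝ) ^ 2 * (1 + (Nat.log 2 q.1 : ℝ)))))
    -- the quantities maintained by CBCE
    (S : ℕ → ℕ × ℕ → ℕ)
    (hS : ∀ t q, S t q =
      1 + ∑ τ ∈ Finset.Icc 1 (t - 1), if q.1 ≤ τ ∧ τ ≤ q.2 then 1 else 0)
    (w gt p : ℕ → ℕ × ℕ → ℝ) (x : ℕ → V)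
    (hw : ∀ t ∈ Finset.Icc 1 T, ∀ q ∈ Active t, w t q =
      (∑ τ ∈ Finset.Icc 1 (t - 1), if q.1 ≤ τ ∧ τ ≤ q.2 then gt τ q else 0) /
          (S t q : ℝ) *
        (1 + ∑ τ ∈ Finset.Icc 1 (t - 1), if q.1 ≤ τ ∧ τ ≤ q.2 then gt τ q * w τ q else 0))
    (hp : ∀ t ∈ Finset.Icc 1 T, ∀ q ∈ Active t, p t q =
      if 0 < ∑ r ∈ Active t, prior r * max (w t r) 0 then
        prior q * max (w t q) 0 / ∑ r ∈ Active t, prior r * max (w t r) 0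
      else prior q / ∑ r ∈ Active t, prior r)
    (hx : ∀ t ∈ Finset.Icc 1 T, x t = ∑ q ∈ Active t, p t q • xB q t)
    (hgt : ∀ t ∈ Finset.Icc 1 T, ∀ q ∈ Active t, gt t q =
      if 0 < w t q then f t (x t) - f t (xB q t)
      else max (f t (x t) - f t (xB q t)) 0)
    -- the comparator set and the black-box regret bound
    (Wc : Set V) (hWc : Wc ⊆ D)
    (α c : ℝ) (hα : α ∈ Set.Ioo (0 : ℝ) 1) (hc : 0 < c)
    (hbb : ∀ q : ℕ × ℕ, isGC q.1 q.2 → q.2 ≤ T → ∀ u ∈ Wc,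
      ∑ t ∈ Finset.Icc q.1 q.2, (f t (xB q t) - f t u) ≤
        c * ((q.2 : ℝ) - q.1 + 1) ^ α)
    -- the interval and the comparator
    (I₁ I₂ : ℕ) (hI1 : 1 ≤ I₁) (hI12 : I₁ ≤ I₂) (hI2T : I₂ ≤ T)
    (u : V) (hu : u ∈ Wc) :
    ∑ t ∈ Finset.Icc I₁ I₂, (f t (x t) - f t u) ≤
      4 / (2 ^ α - 1) * c * ((I₂ : ℝ) - I₁ + 1) ^ α +
        8 * Real.sqrt (((I₂ : ℝ) - I₁ + 1) * (7 * Real.log I₂ + 5)) := by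
  have hZ' : Z = ∑' J : {q : ℕ × ℕ // isGC q.1 q.2}, priorWeight J.1.1 := hZ
  have hZpos : 0 < Z := hZ' ▸ tsum_priorWeight_pos
  have hprior' : ∀ q, prior q = Z⁻¹ * priorWeight q.1 := hprior
  have hprior_nonneg : ∀ q, 0 ≤ prior q := fun q => by
    rw [hprior']; exact mul_nonneg (inv_nonneg.mpr hZpos.le) (priorWeight_nonneg _)
  have hprior_sum : ∀ t ∈ Finset.Icc 1 T, 0 < ∑ r ∈ Active t, prior r := fun t ht =>
    Finset.sum_pos (fun q hq => by
      rw [hprior']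
      exact mul_pos (inv_pos.mpr hZpos) (priorWeight_pos (mem_Active.mp hq).1.one_le))
      (Active_nonempty (Finset.mem_Icc.mp ht).1)
  have hp_nonneg : ∀ t ∈ Finset.Icc 1 T, ∀ q ∈ Active t, 0 ≤ p t q := fun t ht =>
    normalized_nonneg (fun q _ => mul_nonneg (hprior_nonneg q) (le_max_right _ _))
      (fun q _ => hprior_nonneg q) (hp t ht)
  have hp_sum : ∀ t ∈ Finset.Icc 1 T, ∑ q ∈ Active t, p t q = 1 := fun t ht =>
    sum_normalized_eq_one (hprior_sum t ht) (hp t ht)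
  have hxD : ∀ t ∈ Finset.Icc 1 T, x t ∈ D := fun t ht => by
    rw [hx t ht]
    exact hD.sum_mem (hp_nonneg t ht) (hp_sum t ht) (fun q _ => hxB q t)
  have hround : ∀ t ∈ Finset.Icc 1 T,
      ∑ q ∈ Active t, priorWeight q.1 * (gt t q * w t q) ≤ 0 := fun t ht => by
    have hm : f t (x t) ≤ ∑ q ∈ Active t, p t q * f t (xB q t) := by
      rw [hx t ht]
      exact (hfconv t ht).map_sum_le (hp_nonneg t ht) (hp_sum t ht) (fun q _ => hxB q t)
    have h := sum_prior_mul_bet_nonpos (fun q _ => hprior_nonneg q) (hp t ht) (hgt t ht) hm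
    simp only [hprior', mul_assoc, ← Finset.mul_sum] at h
    exact nonpos_of_mul_nonpos_right h (inv_pos.mpr hZpos)
  have hg_abs : ∀ t ∈ Finset.Icc 1 T, ∀ q ∈ Active t, |gt t q| ≤ 1 := fun t ht q hq => by
    have h1 := hf01 t ht _ (hxD t ht)
    have h2 := hf01 t ht _ (hxB q t)
    rw [hgt t ht q hq, abs_le]
    split_ifs
    · constructor <;> linarith [h1.1, h1.2, h2.1, h2.2]
    · exact ⟨by linarith [le_max_right (f t (x t) - f t (xB q t)) 0],
        max_le (by linarith [h1.2, h2.1]) zero_le_one⟩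
  have hg_ge : ∀ t ∈ Finset.Icc 1 T, ∀ q ∈ Active t,
      f t (x t) - f t (xB q t) ≤ gt t q := fun t ht q hq => by
    rw [hgt t ht q hq]
    split_ifs
    · exact le_rfl
    · exact le_max_left _ _
  have hwealth : ∀ q : ℕ × ℕ, isGC q.1 q.2 → _ := fun q hq =>
    abs_le_and_ktPotential_le_wealth (fun t => q.1 ≤ t ∧ t ≤ q.2) T (fun t => gt t q)
      (fun t => w t q) (fun t ht hP => hg_abs t ht q (mem_Active.mpr ⟨hq, hP⟩))
      (fun t ht hP => by rw [← hS t q]; exact hw t ht q (mem_Active.mpr ⟨hq, hP⟩))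
  set L := 7 * Real.log I₂ + 5
  have hblock : ∀ k i : ℕ, 1 ≤ i → (i + 1) * 2 ^ k ≤ I₂ + 1 →
      ∑ t ∈ Finset.Ico (i * 2 ^ k) ((i + 1) * 2 ^ k), (f t (x t) - f t u) ≤
        c * ((2 : ℝ) ^ k) ^ α + Real.sqrt (2 ^ k * L) := by
    intro k i hi hle
    have h2 : 0 < 2 ^ k := by positivity
    have hmul : (i + 1) * 2 ^ k = i * 2 ^ k + 2 ^ k := by ring
    have hk : 2 ^ k ≤ i * 2 ^ k := Nat.le_mul_of_pos_left _ hi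
    set J : ℕ × ℕ := (i * 2 ^ k, (i + 1) * 2 ^ k - 1) with hJdef
    have hJ1 : J.1 = i * 2 ^ k := rfl
    have hJ2 : J.2 + 1 = i * 2 ^ k + 2 ^ k := by
      simp only [hJdef]; omega
    have hJ : isGC J.1 J.2 := ⟨k, i, hi, rfl, rfl⟩
    have hJT : J.2 ≤ T := by omega
    have hIco : Finset.Ico (i * 2 ^ k) ((i + 1) * 2 ^ k) = Finset.Icc J.1 J.2 := by
      ext t; simp only [Finset.mem_Ico, Finset.mem_Icc]; omega
    have hfilter : (Finset.Icc 1 J.2).filter (fun t => J.1 ≤ t ∧ t ≤ J.2)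
        = Finset.Icc J.1 J.2 := by
      ext t; simp only [Finset.mem_filter, Finset.mem_Icc]; omega
    have hlen : (J.2 : ℝ) - J.1 + 1 = 2 ^ k := by
      have : (J.2 : ℝ) + 1 = J.1 + 2 ^ k := by exact_mod_cast hJ2
      linarith
    obtain ⟨hz, hW⟩ := hwealth J hJ J.2 hJT
    have hcard : (∑ τ ∈ Finset.Icc 1 J.2, if J.1 ≤ τ ∧ τ ≤ J.2 then 1 else 0) = 2 ^ k := by
      rw [← Finset.sum_filter, hfilter, Finset.sum_const, Nat.card_Icc, smul_eq_mul, mul_one]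
      omega
    rw [hcard] at hz hW
    have hpos : ∀ q : ℕ × ℕ, isGC q.1 q.2 → 0 ≤ 1 + ∑ τ ∈ Finset.Icc 1 J.2,
        if q.1 ≤ τ ∧ τ ≤ q.2 then gt τ q * w τ q else 0 := fun q hq =>
      (Real.exp_pos _).le.trans (hwealth q hq J.2 hJT).2
    have hmass := priorWeight_mul_wealth_le_tsum J.2 (fun t q => gt t q * w t q)
      (fun t ht => hround t (Finset.Icc_subset_Icc_right hJT ht)) hpos hJ
    have hkt := le_sqrt_of_ktPotential_le (A := J.1) (B := I₂) Nat.one_le_two_pow hJ.one_le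
      (by omega) (by omega) hz (by
        rw [mul_comm]
        exact (mul_le_mul_of_nonneg_left hW (priorWeight_nonneg _)).trans
          (hmass.trans tsum_priorWeight_le_two))
    rw [← Finset.sum_filter, hfilter] at hkt
    have hmeta : ∑ t ∈ Finset.Icc J.1 J.2, (f t (x t) - f t (xB J t)) ≤
        ∑ t ∈ Finset.Icc J.1 J.2, gt t J := Finset.sum_le_sum fun t ht => by
      have ht' := Finset.mem_Icc.mp ht
      exact hg_ge t (Finset.mem_Icc.mpr ⟨hJ.one_le.trans ht'.1, ht'.2.trans hJT⟩) J
        (mem_Active.mpr ⟨hJ, ht'⟩)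
    have hbase := hbb J hJ hJT u hu
    rw [hlen] at hbase
    push_cast at hkt
    have hsplit : ∑ t ∈ Finset.Icc J.1 J.2, (f t (x t) - f t u) =
        ∑ t ∈ Finset.Icc J.1 J.2, (f t (x t) - f t (xB J t)) +
          ∑ t ∈ Finset.Icc J.1 J.2, (f t (xB J t) - f t u) := by
      rw [← Finset.sum_add_distrib]
      exact Finset.sum_congr rfl fun t _ => by ring
    rw [hIco, hsplit]
    linarith
  have hne : I₂ + 1 - I₁ ≠ 0 := by omega
  have hK1 := Nat.pow_log_le_self 2 hne
  have hK2 := Nat.lt_pow_succ_log_self (b := 2) (by norm_num) (I₂ + 1 - I₁)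
  have hIco : Finset.Icc I₁ I₂ = Finset.Ico I₁ (I₂ + 1) := by
    ext t; simp only [Finset.mem_Ico, Finset.mem_Icc]; omega
  rw [hIco]
  refine (sum_Ico_le_two_mul_sum_scales (K := Nat.log 2 (I₂ + 1 - I₁))
    (fun k => by positivity) hblock hI1 (by omega) (by omega)).trans ?_
  refine two_mul_sum_scales_le hα hc ?_
  have : 2 ^ Nat.log 2 (I₂ + 1 - I₁) + I₁ ≤ I₂ + 1 := by omega
  have : (2 : ℝ) ^ Nat.log 2 (I₂ + 1 - I₁) + I₁ ≤ I₂ + 1 := by exact_mod_cast this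
  linarith
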